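/- arXiv:2302.02196 — 7 statements merged into one kernel-verified Lean document; each statement's English description precedes it below -/
import Mathlib

section
/- (Lemma 4.1, b-direction recurrence for the Laplace kernel.) Let U ⊆ ℝ² be an open set on which r > 0. Let b ≥ 1, c ≥ 0, a ≥ 1 be integers. Suppose m₁, m₂ : U → ℝ² are differentiable vector fields satisfying ∇_s·m₁(x,y) = x^{b-1} y^c r^{a} / (4π) and ∇_s·m₂(x,y) = x^{b} y^c r^{a-2} / (4π) for all (x,y) ∈ U. Then the vector field m : U → ℝ² defined by m(x,y) = (1/a) · ( −b·m₁(x,y) + a·x_p·m₂(x,y) + (x^{b} y^c r^{a}/(4π)) · î ), where î = (1,0), satisfies ∇_s·m(x,y) = x^{b+1} y^c r^{a-2} / (4π) on U. -/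
/-- Surface divergence of a planar vector field: ∂_x m₁ + ∂_y m₂. -/
noncomputable def sdiv (m : ℝ × ℝ → ℝ × ℝ) (p : ℝ × ℝ) : ℝ :=
  (fderiv ℝ m p (1, 0)).1 + (fderiv ℝ m p (0, 1)).2

/-- Surface divergence commutes with linear combinations of differentiable fields; a scalar field
times `î` contributes its `x`-derivative. -/
theorem sdiv_smul_combination {m₁ m₂ : ℝ × ℝ → ℝ × ℝ} {F : ℝ × ℝ → ℝ} {p : ℝ × ℝ}
    (h₁ : DifferentiableAt ℝ m₁ p) (h₂ : DifferentiableAt ℝ m₂ p) (hF : DifferentiableAt ℝ F p)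
    (k s t : ℝ) :
    sdiv (fun q => k • (s • m₁ q + t • m₂ q + F q • ((1 : ℝ), (0 : ℝ)))) p =
      k * (s * sdiv m₁ p + t * sdiv m₂ p + fderiv ℝ F p (1, 0)) := by
  have hder := (((h₁.hasFDerivAt.const_smul s).add (h₂.hasFDerivAt.const_smul t)).add
    (hF.hasFDerivAt.smul_const ((1 : ℝ), (0 : ℝ)))).const_smul k
  have heq : fderiv ℝ (fun q => k • (s • m₁ q + t • m₂ q + F q • ((1 : ℝ), (0 : ℝ)))) p = _ :=
    hder.fderiv
  simp only [sdiv, heq]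
  simp
  ring

/-- The regularized distance to `(xp, yp)` has `x`-derivative `(x - xp) / r`. -/
theorem hasFDerivAt_regularized_dist {xp yp h : ℝ} {r : ℝ × ℝ → ℝ}
    (hr : ∀ p : ℝ × ℝ, r p = Real.sqrt ((p.1 - xp) ^ 2 + (p.2 - yp) ^ 2 + h ^ 2))
    {p : ℝ × ℝ} (hp : 0 < r p) :
    DifferentiableAt ℝ r p ∧ fderiv ℝ r p (1, 0) = (p.1 - xp) / r p := by
  have hne : (p.1 - xp) ^ 2 + (p.2 - yp) ^ 2 + h ^ 2 ≠ 0 := by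
    intro h0
    rw [hr, h0, Real.sqrt_zero] at hp
    exact lt_irrefl 0 hp
  have hder := (((((hasFDerivAt_fst (𝕜 := ℝ) (p := p)).sub_const xp).pow 2).add
    (((hasFDerivAt_snd (𝕜 := ℝ) (p := p)).sub_const yp).pow 2)).add_const (h ^ 2)).sqrt hne
  have hder' : HasFDerivAt r _ p := hder.congr_of_eventuallyEq (Filter.Eventually.of_forall hr)
  refine ⟨hder'.differentiableAt, ?_⟩
  rw [hder'.fderiv, hr p]
  simp
  ring

/-- Lemma 4.1: b-direction recurrence for the auxiliary vector fields, Laplace kernel. -/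
theorem stmt0 (xp yp h : ℝ) (U : Set (ℝ × ℝ)) (hU : IsOpen U)
    (r : ℝ × ℝ → ℝ)
    (hr : ∀ p : ℝ × ℝ, r p = Real.sqrt ((p.1 - xp) ^ 2 + (p.2 - yp) ^ 2 + h ^ 2))
    (hrpos : ∀ p ∈ U, 0 < r p)
    (b c a : ℤ) (hb : 1 ≤ b) (hc : 0 ≤ c) (ha : 1 ≤ a)
    (m₁ m₂ : ℝ × ℝ → ℝ × ℝ)
    (hd₁ : ∀ p ∈ U, DifferentiableAt ℝ m₁ p)
    (hd₂ : ∀ p ∈ U, DifferentiableAt ℝ m₂ p)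
    (hm₁ : ∀ p ∈ U, sdiv m₁ p = p.1 ^ (b - 1) * p.2 ^ c * r p ^ a / (4 * Real.pi))
    (hm₂ : ∀ p ∈ U, sdiv m₂ p = p.1 ^ b * p.2 ^ c * r p ^ (a - 2) / (4 * Real.pi))
    (m : ℝ × ℝ → ℝ × ℝ)
    (hm : ∀ p : ℝ × ℝ, m p = (1 / (a : ℝ)) •
      ((-(b : ℝ)) • m₁ p + ((a : ℝ) * xp) • m₂ p
        + (p.1 ^ b * p.2 ^ c * r p ^ a / (4 * Real.pi)) • ((1 : ℝ), (0 : ℝ)))) :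
    ∀ p ∈ U, sdiv m p = p.1 ^ (b + 1) * p.2 ^ c * r p ^ (a - 2) / (4 * Real.pi) := by
  intro p hp
  lift c to ℕ using hc
  obtain ⟨k, rfl⟩ : ∃ k : ℕ, b = k + 1 := ⟨(b - 1).toNat, by omega⟩
  have hrp := hrpos p hp
  have ha0 : (a : ℝ) ≠ 0 := by exact_mod_cast (by omega : a ≠ 0)
  obtain ⟨hrd, hrx⟩ := hasFDerivAt_regularized_dist hr hrp
  have hF := ((((hasFDerivAt_fst (𝕜 := ℝ) (p := p)).pow (k + 1)).mul
    ((hasFDerivAt_snd (𝕜 := ℝ) (p := p)).pow c)).mul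
    ((hasDerivAt_zpow a (r p) (Or.inl hrp.ne')).comp_hasFDerivAt p hrd.hasFDerivAt)).mul_const
    (4 * Real.pi)⁻¹
  have hF' : HasFDerivAt
      (fun q : ℝ × ℝ => q.1 ^ ((k : ℤ) + 1) * q.2 ^ (c : ℤ) * r q ^ a / (4 * Real.pi)) _ p :=
    hF.congr_of_eventuallyEq (Filter.Eventually.of_forall fun q => by
      simp [div_eq_mul_inv, ← zpow_natCast])
  rw [funext hm, sdiv_smul_combination (hd₁ p hp) (hd₂ p hp) hF'.differentiableAt,
    hm₁ p hp, hm₂ p hp, hF'.fderiv]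
  have e₁ : (k : ℤ) + 1 = ((k + 1 : ℕ) : ℤ) := by push_cast; ring
  have e₂ : (k : ℤ) + 1 + 1 = ((k + 2 : ℕ) : ℤ) := by push_cast; ring
  have e₃ : r p ^ (a - 1) = r p ^ (a - 2) * r p := by
    rw [← zpow_add_one₀ hrp.ne']; congr 1; ring
  rw [add_sub_cancel_right, e₂, e₁]
  simp only [zpow_natCast]
  simp [hrx, e₃]
  field_simp
  ring
end

section
/- (c-direction recurrence for the Laplace kernel, the symmetric counterpart of Lemma 4.1.) Let U ⊆ ℝ² be an open set on which r > 0. Let b ≥ 0, c ≥ 1, a ≥ 1 be integers. Suppose m₁, m₂ : U → ℝ² are differentiable vector fields satisfying ∇_s·m₁(x,y) = x^{b} y^{c-1} r^{a} / (4π) and ∇_s·m₂(x,y) = x^{b} y^{c} r^{a-2} / (4π) for all (x,y) ∈ U. Then the vector field m : U → ℝ² defined by m(x,y) = (1/a) · ( −c·m₁(x,y) + a·y_p·m₂(x,y) + (x^{b} y^{c} r^{a}/(4π)) · ĵ ), where ĵ = (0,1), satisfies ∇_s·m(x,y) = x^{b} y^{c+1} r^{a-2} / (4π) on U. -/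
theorem sdiv_add {m n : ℝ × ℝ → ℝ × ℝ} {p : ℝ × ℝ} (hm : DifferentiableAt ℝ m p)
    (hn : DifferentiableAt ℝ n p) : sdiv (fun q => m q + n q) p = sdiv m p + sdiv n p := by
  simp only [sdiv, fderiv_fun_add hm hn, add_apply, Prod.fst_add,
    Prod.snd_add]
  ring

theorem sdiv_const_smul (k : ℝ) {m : ℝ × ℝ → ℝ × ℝ} {p : ℝ × ℝ} (hm : DifferentiableAt ℝ m p) :
    sdiv (fun q => k • m q) p = k * sdiv m p := by
  simp only [sdiv, fderiv_fun_const_smul hm, smul_apply, Prod.smul_fst,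
    Prod.smul_snd, smul_eq_mul]
  ring

theorem sdiv_smul_snd {f : ℝ × ℝ → ℝ} {f' : ℝ × ℝ →L[ℝ] ℝ} {p : ℝ × ℝ} (hf : HasFDerivAt f f' p) :
    sdiv (fun q => f q • ((0 : ℝ), (1 : ℝ))) p = f' (0, 1) := by
  rw [sdiv, (hf.smul_const ((0 : ℝ), (1 : ℝ))).fderiv]
  simp

/-- The gradient of the distance to a point at height `h` above the plane. -/
theorem hasFDerivAt_sqrt_sq_add_sq (xp yp h : ℝ) {p : ℝ × ℝ}
    (hp : 0 < √((p.1 - xp) ^ 2 + (p.2 - yp) ^ 2 + h ^ 2)) :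
    HasFDerivAt (fun q : ℝ × ℝ => √((q.1 - xp) ^ 2 + (q.2 - yp) ^ 2 + h ^ 2))
      ((√((p.1 - xp) ^ 2 + (p.2 - yp) ^ 2 + h ^ 2))⁻¹ •
        ((p.1 - xp) • ContinuousLinearMap.fst ℝ ℝ ℝ +
          (p.2 - yp) • ContinuousLinearMap.snd ℝ ℝ ℝ)) p := by
  have hx : HasFDerivAt (fun q : ℝ × ℝ => q.1 - xp) (ContinuousLinearMap.fst ℝ ℝ ℝ) p :=
    hasFDerivAt_fst.sub_const xp
  have hy : HasFDerivAt (fun q : ℝ × ℝ => q.2 - yp) (ContinuousLinearMap.snd ℝ ℝ ℝ) p :=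
    hasFDerivAt_snd.sub_const yp
  refine ((((hx.pow 2).fun_add (hy.pow 2)).add_const (h ^ 2)).sqrt
    (Real.sqrt_pos.mp hp).ne').congr_fderiv ?_
  ext <;> simp <;> field_simp

/-- c-direction recurrence for the auxiliary vector fields, Laplace kernel. -/
theorem stmt1 (xp yp h : ℝ) (U : Set (ℝ × ℝ)) (hU : IsOpen U)
    (r : ℝ × ℝ → ℝ)
    (hr : ∀ p : ℝ × ℝ, r p = Real.sqrt ((p.1 - xp) ^ 2 + (p.2 - yp) ^ 2 + h ^ 2))
    (hrpos : ∀ p ∈ U, 0 < r p)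
    (b c a : ℤ) (hb : 0 ≤ b) (hc : 1 ≤ c) (ha : 1 ≤ a)
    (m₁ m₂ : ℝ × ℝ → ℝ × ℝ)
    (hd₁ : ∀ p ∈ U, DifferentiableAt ℝ m₁ p)
    (hd₂ : ∀ p ∈ U, DifferentiableAt ℝ m₂ p)
    (hm₁ : ∀ p ∈ U, sdiv m₁ p = p.1 ^ b * p.2 ^ (c - 1) * r p ^ a / (4 * Real.pi))
    (hm₂ : ∀ p ∈ U, sdiv m₂ p = p.1 ^ b * p.2 ^ c * r p ^ (a - 2) / (4 * Real.pi))
    (m : ℝ × ℝ → ℝ × ℝ)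
    (hm : ∀ p : ℝ × ℝ, m p = (1 / (a : ℝ)) •
      ((-(c : ℝ)) • m₁ p + ((a : ℝ) * yp) • m₂ p
        + (p.1 ^ b * p.2 ^ c * r p ^ a / (4 * Real.pi)) • ((0 : ℝ), (1 : ℝ)))) :
    ∀ p ∈ U, sdiv m p = p.1 ^ b * p.2 ^ (c + 1) * r p ^ (a - 2) / (4 * Real.pi) := by
  intro p hp
  lift b to ℕ using hb
  obtain ⟨n, rfl⟩ : ∃ n : ℕ, c = n + 1 := ⟨(c - 1).toNat, by lia⟩
  obtain ⟨k, rfl⟩ : ∃ k : ℕ, a = k + 1 := ⟨(a - 1).toNat, by lia⟩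
  have hp0 := hrpos p hp
  have hr' : HasFDerivAt r ((r p)⁻¹ • ((p.1 - xp) • ContinuousLinearMap.fst ℝ ℝ ℝ +
      (p.2 - yp) • ContinuousLinearMap.snd ℝ ℝ ℝ)) p := by
    obtain rfl := funext hr
    exact hasFDerivAt_sqrt_sq_add_sq xp yp h hp0
  have hg := ((((hasFDerivAt_fst (𝕜 := ℝ) (p := p)).pow b).fun_mul
    ((hasFDerivAt_snd (𝕜 := ℝ) (p := p)).pow (n + 1))).fun_mul (hr'.pow (k + 1))).mul_const
      (4 * Real.pi)⁻¹
  have hm' : m = fun q => (1 / (((k + 1 : ℤ) : ℝ))) •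
      ((-((n + 1 : ℤ) : ℝ)) • m₁ q + (((k + 1 : ℤ) : ℝ) * yp) • m₂ q
        + (q.1 ^ b * q.2 ^ (n + 1) * r q ^ (k + 1) * (4 * Real.pi)⁻¹) • ((0 : ℝ), (1 : ℝ))) := by
    funext q
    rw [hm q, div_eq_mul_inv _ (4 * Real.pi)]
    norm_cast
  have h₁ := (hd₁ p hp).fun_const_smul (-((n + 1 : ℤ) : ℝ))
  have h₂ := (hd₂ p hp).fun_const_smul (((k + 1 : ℤ) : ℝ) * yp)
  have h₃ := (hg.smul_const ((0 : ℝ), (1 : ℝ))).differentiableAt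
  have hdiv := sdiv_smul_snd hg
  have hpow : r p ^ ((k : ℤ) + 1 - 2) = r p ^ k / r p := by
    rw [show (k : ℤ) + 1 - 2 = k - 1 by ring, zpow_sub_one₀ hp0.ne', zpow_natCast, div_eq_mul_inv]
  have hcast : ∀ (x : ℝ) (j : ℕ), x ^ ((j : ℤ) + 1) = x ^ (j + 1) := fun x j => by norm_cast
  have hcast₂ : p.2 ^ ((n : ℤ) + 1 + 1) = p.2 ^ (n + 2) := by norm_cast
  rw [hm', sdiv_const_smul _ ((h₁.fun_add h₂).fun_add h₃), sdiv_add (h₁.fun_add h₂) h₃,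
    sdiv_add h₁ h₂, sdiv_const_smul _ (hd₁ p hp), sdiv_const_smul _ (hd₂ p hp), hm₁ p hp,
    hm₂ p hp, hdiv, hpow, hcast₂, hcast, hcast, add_sub_cancel_right, zpow_natCast, zpow_natCast]
  simp
  field_simp
  ring
end

section
/- (Divergence of the Laplace seed field, validity of equation (4.15).) Let a be an integer with a ≠ −1 (in the paper a ≥ 0). On the open set U = {(x,y) ∈ ℝ² : ρ > 0}, the vector field m_{0,0,a}(x,y) = r^{a+1} / ((a+1)·4π·ρ²) · (x−x_p, y−y_p) is differentiable and satisfies ∇_s·m_{0,0,a}(x,y) = r^{a-1} / (4π) for all (x,y) ∈ U. -/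
/-- The divergence of the planar radial field `g (|p - c|²) • (p - c)`. -/
theorem sdiv_radial {g : ℝ → ℝ} {g' xp yp : ℝ} {p : ℝ × ℝ}
    (hg : HasDerivAt g g' ((p.1 - xp) ^ 2 + (p.2 - yp) ^ 2)) :
    let m := fun q : ℝ × ℝ ↦ g ((q.1 - xp) ^ 2 + (q.2 - yp) ^ 2) • (q.1 - xp, q.2 - yp)
    DifferentiableAt ℝ m p ∧
      sdiv m p = 2 * g ((p.1 - xp) ^ 2 + (p.2 - yp) ^ 2) +
        2 * ((p.1 - xp) ^ 2 + (p.2 - yp) ^ 2) * g' := by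
  intro m
  have h₁ : HasFDerivAt (fun q : ℝ × ℝ ↦ q.1 - xp) (ContinuousLinearMap.fst ℝ ℝ ℝ) p :=
    hasFDerivAt_fst.sub_const xp
  have h₂ : HasFDerivAt (fun q : ℝ × ℝ ↦ q.2 - yp) (ContinuousLinearMap.snd ℝ ℝ ℝ) p :=
    hasFDerivAt_snd.sub_const yp
  have hm : HasFDerivAt m _ p :=
    (hg.comp_hasFDerivAt p ((h₁.pow 2).add (h₂.pow 2))).smul (h₁.prodMk h₂)
  refine ⟨hm.differentiableAt, ?_⟩
  rw [sdiv, hm.fderiv]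
  simp
  ring

/-- The profile `√(t + b) ^ (n + 1) / (c * t)` of the Laplace seed field. -/
theorem hasDerivAt_sqrt_zpow_div {b c t : ℝ} (n : ℤ) (hc : c ≠ 0) (ht : 0 < t) (htb : 0 < t + b) :
    HasDerivAt (fun t : ℝ ↦ Real.sqrt (t + b) ^ (n + 1) / (c * t))
      (((n : ℝ) + 1) * Real.sqrt (t + b) ^ (n - 1) / (2 * c * t) -
        Real.sqrt (t + b) ^ (n + 1) / (c * t ^ 2)) t := by
  have hs : 0 < Real.sqrt (t + b) := Real.sqrt_pos.2 htb
  have hsqrt := ((hasDerivAt_id' t).add_const b).sqrt htb.ne'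
  have hpow := (hasDerivAt_zpow (n + 1) (Real.sqrt (t + b)) (Or.inl hs.ne')).comp t hsqrt
  have hdiv := hpow.div ((hasDerivAt_id' t).const_mul c) (mul_ne_zero hc ht.ne')
  refine hdiv.congr_deriv ?_
  have h₁ : Real.sqrt (t + b) ^ (n + 1 - 1) = Real.sqrt (t + b) ^ (n - 1) * Real.sqrt (t + b) := by
    rw [← zpow_add_one₀ hs.ne']
    congr 1
    ring
  simp only [Function.comp_apply, h₁]
  push_cast
  field_simp

/-- Divergence of the Laplace seed field m_{0,0,a}, equation (4.15). -/
theorem stmt2 (xp yp h : ℝ) (a : ℤ) (ha : a ≠ -1)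
    (r ρ : ℝ × ℝ → ℝ)
    (hr : ∀ p : ℝ × ℝ, r p = Real.sqrt ((p.1 - xp) ^ 2 + (p.2 - yp) ^ 2 + h ^ 2))
    (hρ : ∀ p : ℝ × ℝ, ρ p = Real.sqrt ((p.1 - xp) ^ 2 + (p.2 - yp) ^ 2))
    (m : ℝ × ℝ → ℝ × ℝ)
    (hm : ∀ p : ℝ × ℝ, m p =
      (r p ^ (a + 1) / (((a : ℝ) + 1) * 4 * Real.pi * ρ p ^ 2)) • (p.1 - xp, p.2 - yp)) :
    ∀ p ∈ {p : ℝ × ℝ | 0 < ρ p},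
      DifferentiableAt ℝ m p ∧ sdiv m p = r p ^ (a - 1) / (4 * Real.pi) := by
  intro p hp
  have ht : 0 < (p.1 - xp) ^ 2 + (p.2 - yp) ^ 2 := by
    simpa [hρ, Real.sqrt_pos] using hp
  have ha' : (a : ℝ) + 1 ≠ 0 := by
    exact_mod_cast fun h0 : a + 1 = 0 ↦ ha (by omega)
  have hc : ((a : ℝ) + 1) * 4 * Real.pi ≠ 0 := by
    have := Real.pi_ne_zero
    positivity
  have hm' : m = fun q : ℝ × ℝ ↦
      (fun t : ℝ ↦ Real.sqrt (t + h ^ 2) ^ (a + 1) / (((a : ℝ) + 1) * 4 * Real.pi * t))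
        ((q.1 - xp) ^ 2 + (q.2 - yp) ^ 2) • (q.1 - xp, q.2 - yp) := by
    funext q
    rw [hm, hr, hρ, Real.sq_sqrt (by positivity)]
  obtain ⟨hd, hdiv⟩ := sdiv_radial (hasDerivAt_sqrt_zpow_div (b := h ^ 2) a hc ht (by positivity))
  rw [hm']
  refine ⟨hd, hdiv.trans ?_⟩
  rw [hr]
  generalize (p.1 - xp) ^ 2 + (p.2 - yp) ^ 2 = t at ht ⊢
  field_simp
  ring
end

section
/- (Lemma 4.3, recurrence for auxiliary vector fields for the Helmholtz kernel.) Let k > 0 be real and let U ⊆ ℝ² be an open set on which r > 0. Let b ≥ 1, c ≥ 0, a ≥ 1 be integers. Suppose m₁, m₂, m₃, m₄ : U → ℂ² are differentiable vector fields satisfying ∇_s·m₁ = x^{b} y^c r^{a-1} e^{ikr}/(4π), ∇_s·m₂ = x^{b+1} y^c r^{a-1} e^{ikr}/(4π), ∇_s·m₃ = x^{b-1} y^c r^{a} e^{ikr}/(4π), and ∇_s·m₄ = x^{b} y^c r^{a-2} e^{ikr}/(4π) on U. Then the vector field m : U → ℂ² defined by m = (ik/a)·( x_p·m₁ − m₂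 − (b/(ik))·m₃ + (a·x_p/(ik))·m₄ + (x^{b} y^{c} r^a e^{ikr}/(4π·ik))·î ), where î = (1,0), satisfies ∇_s·m = x^{b+1} y^c r^{a-2} e^{ikr}/(4π) on U. -/
/-- Surface divergence of a planar complex vector field: ∂_x m₁ + ∂_y m₂. -/
noncomputable def sdivC (m : ℝ × ℝ → ℂ × ℂ) (p : ℝ × ℝ) : ℂ :=
  (fderiv ℝ m p (1, 0)).1 + (fderiv ℝ m p (0, 1)).2

theorem sdivC_add {m n : ℝ × ℝ → ℂ × ℂ} {p : ℝ × ℝ} (hm : DifferentiableAt ℝ m p)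
    (hn : DifferentiableAt ℝ n p) :
    sdivC (fun q => m q + n q) p = sdivC m p + sdivC n p := by
  simp only [sdivC, fderiv_fun_add hm hn, add_apply, Prod.fst_add,
    Prod.snd_add]
  ring

theorem sdivC_sub {m n : ℝ × ℝ → ℂ × ℂ} {p : ℝ × ℝ} (hm : DifferentiableAt ℝ m p)
    (hn : DifferentiableAt ℝ n p) :
    sdivC (fun q => m q - n q) p = sdivC m p - sdivC n p := by
  simp only [sdivC, fderiv_fun_sub hm hn, sub_apply, Prod.fst_sub,
    Prod.snd_sub]
  ring

theorem sdivC_const_smul {m : ℝ × ℝ → ℂ × ℂ} {p : ℝ × ℝ} (z : ℂ) (hm : DifferentiableAt ℝ m p) :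
    sdivC (fun q => z • m q) p = z * sdivC m p := by
  simp only [sdivC, fderiv_fun_const_smul hm z, smul_apply, Prod.smul_fst,
    Prod.smul_snd, smul_eq_mul]
  ring

theorem sdivC_smul_fst {g : ℝ × ℝ → ℂ} {g' : ℝ × ℝ →L[ℝ] ℂ} {p : ℝ × ℝ}
    (hg : HasFDerivAt g g' p) :
    sdivC (fun q => g q • ((1 : ℂ), (0 : ℂ))) p = g' (1, 0) := by
  simp only [sdivC, (hg.smul_const ((1 : ℂ), (0 : ℂ))).fderiv]
  simp

/-- The distance to a fixed point off the plane has `x`-derivative `(x - x_p) / r`. -/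
theorem exists_hasFDerivAt_dist (xp yp h : ℝ) {p : ℝ × ℝ}
    (hp : 0 < Real.sqrt ((p.1 - xp) ^ 2 + (p.2 - yp) ^ 2 + h ^ 2)) :
    ∃ L : ℝ × ℝ →L[ℝ] ℝ,
      HasFDerivAt (fun q : ℝ × ℝ => Real.sqrt ((q.1 - xp) ^ 2 + (q.2 - yp) ^ 2 + h ^ 2)) L p ∧
      L (1, 0) = (p.1 - xp) / Real.sqrt ((p.1 - xp) ^ 2 + (p.2 - yp) ^ 2 + h ^ 2) := by
  have hx : HasFDerivAt (fun q : ℝ × ℝ => q.1) (ContinuousLinearMap.fst ℝ ℝ ℝ) p := hasFDerivAt_fst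
  have hy : HasFDerivAt (fun q : ℝ × ℝ => q.2) (ContinuousLinearMap.snd ℝ ℝ ℝ) p := hasFDerivAt_snd
  refine ⟨_, ((((hx.sub_const xp).pow 2).add ((hy.sub_const yp).pow 2)).add_const
    (h ^ 2)).sqrt (Real.sqrt_pos.1 hp).ne', ?_⟩
  simp
  field_simp

/-- The `x`-derivative of `x ^ b * y ^ c * r ^ a * exp (i k r)`, for any `r` with
`∂r/∂x = d / r`. -/
theorem exists_hasFDerivAt_monomial_mul_exp {r : ℝ × ℝ → ℝ} {L : ℝ × ℝ →L[ℝ] ℝ} {p : ℝ × ℝ}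
    {d : ℝ} (hr : HasFDerivAt r L p) (hL : L (1, 0) = d / r p) (hrp : r p ≠ 0) (κ : ℂ)
    {b c : ℤ} (hb : 0 ≤ b) (hc : 0 ≤ c) (a : ℤ) :
    ∃ F : ℝ × ℝ →L[ℝ] ℂ,
      HasFDerivAt (fun q : ℝ × ℝ => (q.1 : ℂ) ^ b * (q.2 : ℂ) ^ c * (r q : ℂ) ^ a *
        Complex.exp (κ * (r q : ℂ))) F p ∧
      F (1, 0) = (b * (p.1 : ℂ) ^ (b - 1) * (r p : ℂ) ^ a +
        (p.1 : ℂ) ^ b * d * (a * (r p : ℂ) ^ (a - 2) + κ * (r p : ℂ) ^ (a - 1))) *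
        (p.2 : ℂ) ^ c * Complex.exp (κ * (r p : ℂ)) := by
  have hrc : (r p : ℂ) ≠ 0 := by exact_mod_cast hrp
  have hx := (hasDerivAt_zpow b (p.1 : ℂ) (Or.inr hb)).comp_hasFDerivAt p
    (Complex.ofRealCLM.hasFDerivAt.comp p (hasFDerivAt_fst (𝕜 := ℝ) (p := p)))
  have hy := (hasDerivAt_zpow c (p.2 : ℂ) (Or.inr hc)).comp_hasFDerivAt p
    (Complex.ofRealCLM.hasFDerivAt.comp p (hasFDerivAt_snd (𝕜 := ℝ) (p := p)))
  have hR := Complex.ofRealCLM.hasFDerivAt.comp p hr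
  have hra := (hasDerivAt_zpow a (r p : ℂ) (Or.inl hrc)).comp_hasFDerivAt p hR
  refine ⟨_, ((hx.mul hy).mul hra).mul (hR.const_mul κ).cexp, ?_⟩
  have h1 : (r p : ℂ) ^ (a - 1) = (r p : ℂ) ^ (a - 2) * r p := by
    rw [← zpow_add_one₀ hrc]; ring_nf
  have h2 : (r p : ℂ) ^ a = (r p : ℂ) ^ (a - 2) * r p * r p := by
    rw [← h1, ← zpow_add_one₀ hrc]; ring_nf
  simp [hL, h1, h2]
  field_simp
  ring

/-- Lemma 4.3: recurrence for the auxiliary vector fields, Helmholtz kernel. -/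
theorem stmt4 (xp yp h k : ℝ) (hk : 0 < k) (U : Set (ℝ × ℝ)) (hU : IsOpen U)
    (r : ℝ × ℝ → ℝ)
    (hr : ∀ p : ℝ × ℝ, r p = Real.sqrt ((p.1 - xp) ^ 2 + (p.2 - yp) ^ 2 + h ^ 2))
    (hrpos : ∀ p ∈ U, 0 < r p)
    (b c a : ℤ) (hb : 1 ≤ b) (hc : 0 ≤ c) (ha : 1 ≤ a)
    (m₁ m₂ m₃ m₄ : ℝ × ℝ → ℂ × ℂ)
    (hd₁ : ∀ p ∈ U, DifferentiableAt ℝ m₁ p)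
    (hd₂ : ∀ p ∈ U, DifferentiableAt ℝ m₂ p)
    (hd₃ : ∀ p ∈ U, DifferentiableAt ℝ m₃ p)
    (hd₄ : ∀ p ∈ U, DifferentiableAt ℝ m₄ p)
    (hm₁ : ∀ p ∈ U, sdivC m₁ p = (p.1 : ℂ) ^ b * (p.2 : ℂ) ^ c * (r p : ℂ) ^ (a - 1) *
      Complex.exp (Complex.I * (k : ℂ) * (r p : ℂ)) / (4 * (Real.pi : ℂ)))
    (hm₂ : ∀ p ∈ U, sdivC m₂ p = (p.1 : ℂ) ^ (b + 1) * (p.2 : ℂ) ^ c * (r p : ℂ) ^ (a - 1) *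
      Complex.exp (Complex.I * (k : ℂ) * (r p : ℂ)) / (4 * (Real.pi : ℂ)))
    (hm₃ : ∀ p ∈ U, sdivC m₃ p = (p.1 : ℂ) ^ (b - 1) * (p.2 : ℂ) ^ c * (r p : ℂ) ^ a *
      Complex.exp (Complex.I * (k : ℂ) * (r p : ℂ)) / (4 * (Real.pi : ℂ)))
    (hm₄ : ∀ p ∈ U, sdivC m₄ p = (p.1 : ℂ) ^ b * (p.2 : ℂ) ^ c * (r p : ℂ) ^ (a - 2) *
      Complex.exp (Complex.I * (k : ℂ) * (r p : ℂ)) / (4 * (Real.pi : ℂ)))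
    (m : ℝ × ℝ → ℂ × ℂ)
    (hm : ∀ p : ℝ × ℝ, m p = ((Complex.I * (k : ℂ)) / (a : ℂ)) •
      ((xp : ℂ) • m₁ p - m₂ p - ((b : ℂ) / (Complex.I * (k : ℂ))) • m₃ p
        + (((a : ℂ) * (xp : ℂ)) / (Complex.I * (k : ℂ))) • m₄ p
        + ((p.1 : ℂ) ^ b * (p.2 : ℂ) ^ c * (r p : ℂ) ^ a *
            Complex.exp (Complex.I * (k : ℂ) * (r p : ℂ)) /
            (4 * (Real.pi : ℂ) * (Complex.I * (k : ℂ)))) • ((1 : ℂ), (0 : ℂ)))) :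
    ∀ p ∈ U, sdivC m p = (p.1 : ℂ) ^ (b + 1) * (p.2 : ℂ) ^ c * (r p : ℂ) ^ (a - 2) *
      Complex.exp (Complex.I * (k : ℂ) * (r p : ℂ)) / (4 * (Real.pi : ℂ)) := by
  intro p hp
  have hrp := hrpos p hp
  obtain ⟨L, hrL, hL⟩ : ∃ L, HasFDerivAt r L p ∧ L (1, 0) = (p.1 - xp) / r p := by
    rw [hr p] at hrp ⊢
    rw [funext hr]
    exact exists_hasFDerivAt_dist xp yp h hrp
  obtain ⟨F, hF, hF1⟩ := exists_hasFDerivAt_monomial_mul_exp hrL hL hrp.ne'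
    (Complex.I * (k : ℂ)) (zero_le_one.trans hb) hc a
  have hG := hF.mul_const (4 * (Real.pi : ℂ) * (Complex.I * (k : ℂ)))⁻¹
  simp only [← div_eq_mul_inv] at hG
  have e₁ := (hd₁ p hp).fun_const_smul (xp : ℂ)
  have e₃ := (hd₃ p hp).fun_const_smul ((b : ℂ) / (Complex.I * (k : ℂ)))
  have e₄ := (hd₄ p hp).fun_const_smul (((a : ℂ) * (xp : ℂ)) / (Complex.I * (k : ℂ)))
  have e₅ := (hG.smul_const ((1 : ℂ), (0 : ℂ))).differentiableAt
  have e₁₂ := e₁.fun_sub (hd₂ p hp)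
  have e₁₃ := e₁₂.fun_sub e₃
  have e₁₄ := e₁₃.fun_add e₄
  have ha0 : (a : ℂ) ≠ 0 := by exact_mod_cast (by lia : a ≠ 0)
  have hk0 : (k : ℂ) ≠ 0 := by exact_mod_cast hk.ne'
  have hπ : (Real.pi : ℂ) ≠ 0 := by exact_mod_cast Real.pi_ne_zero
  have hxb : (p.1 : ℂ) ^ (b + 1) = (p.1 : ℂ) ^ b * p.1 := by
    rw [zpow_add' (by lia), zpow_one]
  rw [funext hm, sdivC_const_smul _ (e₁₄.fun_add e₅), sdivC_add e₁₄ e₅, sdivC_add e₁₃ e₄,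
    sdivC_sub e₁₂ e₃, sdivC_sub e₁ (hd₂ p hp), sdivC_const_smul _ (hd₁ p hp),
    sdivC_const_smul _ (hd₃ p hp), sdivC_const_smul _ (hd₄ p hp), sdivC_smul_fst hG,
    hm₁ p hp, hm₂ p hp, hm₃ p hp, hm₄ p hp, smul_apply, hF1, hxb]
  simp only [smul_eq_mul, Complex.ofReal_sub]
  generalize (p.1 : ℂ) ^ b = X
  field_simp
  ring
end

section
/- (Helmholtz a-axis recurrence for the seed fields, equation (4.40).) Let k > 0 be real, let a ≥ 0 be an integer, and let U ⊆ ℝ² be an open set on which ρ > 0. If the differentiable field m : U → ℂ² satisfies ∇_s·m = r^{a-1} e^{ikr}/(4π) on U, then the field m' = −((a+1)/(ik))·m + (1/(ik))·χ_{a+1}, where χ_{a+1}(x,y) = r^{a+1} e^{ikr} / (4π ρ²) · (x−x_p, y−y_p), satisfies ∇_s·m' = r^{a} e^{ikr}/(4π) on U. -/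
theorem sdivC_smul_add_smul {m n : ℝ × ℝ → ℂ × ℂ} {p : ℝ × ℝ} (c d : ℂ)
    (hm : DifferentiableAt ℝ m p) (hn : DifferentiableAt ℝ n p) :
    sdivC (fun q => c • m q + d • n q) p = c * sdivC m p + d * sdivC n p := by
  have hfd := (hm.hasFDerivAt.const_smul c).add (hn.hasFDerivAt.const_smul d)
  have heq : fderiv ℝ (fun q => c • m q + d • n q) p = _ := hfd.fderiv
  simp only [sdivC, heq, add_apply, smul_apply, Prod.fst_add, Prod.snd_add, Prod.smul_fst,
    Prod.smul_snd, smul_eq_mul]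
  ring

/-- The derivative of a radial field whose amplitude is a function of the squared distance. -/
theorem hasFDerivAt_radial (x₀ y₀ : ℝ) {G : ℝ → ℂ} {G' : ℂ} {p : ℝ × ℝ}
    (hG : HasDerivAt G G' ((p.1 - x₀) ^ 2 + (p.2 - y₀) ^ 2)) :
    ∃ L : ℝ × ℝ →L[ℝ] ℂ × ℂ,
      HasFDerivAt (fun q : ℝ × ℝ => G ((q.1 - x₀) ^ 2 + (q.2 - y₀) ^ 2) •
        (((q.1 - x₀ : ℝ) : ℂ), ((q.2 - y₀ : ℝ) : ℂ))) L p ∧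
      (L (1, 0)).1 + (L (0, 1)).2 =
        2 * ((((p.1 - x₀) ^ 2 + (p.2 - y₀) ^ 2 : ℝ) : ℂ) * G' +
          G ((p.1 - x₀) ^ 2 + (p.2 - y₀) ^ 2)) := by
  have hx : HasFDerivAt (fun q : ℝ × ℝ => q.1 - x₀) (ContinuousLinearMap.fst ℝ ℝ ℝ) p :=
    hasFDerivAt_fst.sub_const x₀
  have hy : HasFDerivAt (fun q : ℝ × ℝ => q.2 - y₀) (ContinuousLinearMap.snd ℝ ℝ ℝ) p :=
    hasFDerivAt_snd.sub_const y₀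
  have hamp := hG.hasFDerivAt.comp p ((hx.pow 2).add (hy.pow 2))
  have hvec := (Complex.ofRealCLM.hasFDerivAt.comp p hx).prodMk
    (Complex.ofRealCLM.hasFDerivAt.comp p hy)
  refine ⟨_, hamp.smul hvec, ?_⟩
  simp
  ring

theorem sdivC_radial (x₀ y₀ : ℝ) {G : ℝ → ℂ} {G' : ℂ} {p : ℝ × ℝ}
    (hG : HasDerivAt G G' ((p.1 - x₀) ^ 2 + (p.2 - y₀) ^ 2)) :
    sdivC (fun q : ℝ × ℝ => G ((q.1 - x₀) ^ 2 + (q.2 - y₀) ^ 2) •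
        (((q.1 - x₀ : ℝ) : ℂ), ((q.2 - y₀ : ℝ) : ℂ))) p =
      2 * ((((p.1 - x₀) ^ 2 + (p.2 - y₀) ^ 2 : ℝ) : ℂ) * G' +
        G ((p.1 - x₀) ^ 2 + (p.2 - y₀) ^ 2)) := by
  obtain ⟨L, hL, hdiv⟩ := hasFDerivAt_radial x₀ y₀ hG
  rw [sdivC, hL.fderiv, hdiv]

theorem hasDerivAt_amplitude (h : ℝ) {F : ℝ → ℂ} {F' : ℂ} {s : ℝ} (hs : 0 < s)
    (hF : HasDerivAt F F' (Real.sqrt (s + h ^ 2))) :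
    HasDerivAt (fun t : ℝ => F (Real.sqrt (t + h ^ 2)) / (t : ℂ))
      (F' / (2 * (Real.sqrt (s + h ^ 2) : ℂ) * (s : ℂ)) -
        F (Real.sqrt (s + h ^ 2)) / (s : ℂ) ^ 2) s := by
  have hpos : 0 < s + h ^ 2 := by positivity
  have hr : (Real.sqrt (s + h ^ 2) : ℂ) ≠ 0 := by
    exact_mod_cast (Real.sqrt_pos.2 hpos).ne'
  have hs' : (s : ℂ) ≠ 0 := by exact_mod_cast hs.ne'
  have hsqrt := ((hasDerivAt_id s).add_const (h ^ 2)).sqrt hpos.ne'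
  have hnum := HasDerivAt.scomp s hF hsqrt
  refine (hnum.div (hasDerivAt_id s).ofReal_comp hs').congr_deriv ?_
  simp
  field_simp

theorem hasDerivAt_zpow_mul_cexp (k : ℝ) (n : ℤ) {t : ℝ} (ht : t ≠ 0) :
    HasDerivAt (fun u : ℝ => (u : ℂ) ^ (n + 1) * Complex.exp (Complex.I * (k : ℂ) * (u : ℂ)))
      ((((n : ℂ) + 1) * (t : ℂ) ^ n + Complex.I * (k : ℂ) * (t : ℂ) ^ (n + 1)) *
        Complex.exp (Complex.I * (k : ℂ) * (t : ℂ))) t := by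
  have ht' : (t : ℂ) ≠ 0 := by exact_mod_cast ht
  have hexp := ((hasDerivAt_id (t : ℂ)).const_mul (Complex.I * (k : ℂ))).cexp
  refine ((hasDerivAt_zpow (n + 1) (t : ℂ) (Or.inl ht')).mul hexp).comp_ofReal.congr_deriv ?_
  simp
  ring

/-- Helmholtz a-axis recurrence for the seed fields, equation (4.40). -/
theorem stmt6 (xp yp h k : ℝ) (hk : 0 < k) (a : ℤ) (ha : 0 ≤ a)
    (U : Set (ℝ × ℝ)) (hU : IsOpen U)
    (r ρ : ℝ × ℝ → ℝ)
    (hr : ∀ p : ℝ × ℝ, r p = Real.sqrt ((p.1 - xp) ^ 2 + (p.2 - yp) ^ 2 + h ^ 2))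
    (hρ : ∀ p : ℝ × ℝ, ρ p = Real.sqrt ((p.1 - xp) ^ 2 + (p.2 - yp) ^ 2))
    (hρpos : ∀ p ∈ U, 0 < ρ p)
    (m : ℝ × ℝ → ℂ × ℂ)
    (hd : ∀ p ∈ U, DifferentiableAt ℝ m p)
    (hm : ∀ p ∈ U, sdivC m p = (r p : ℂ) ^ (a - 1) *
      Complex.exp (Complex.I * (k : ℂ) * (r p : ℂ)) / (4 * (Real.pi : ℂ)))
    (χ : ℝ × ℝ → ℂ × ℂ)
    (hχ : ∀ p : ℝ × ℝ, χ p =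
      ((r p : ℂ) ^ (a + 1) * Complex.exp (Complex.I * (k : ℂ) * (r p : ℂ)) /
        (4 * (Real.pi : ℂ) * (ρ p : ℂ) ^ 2)) • (((p.1 - xp : ℝ) : ℂ), ((p.2 - yp : ℝ) : ℂ)))
    (m' : ℝ × ℝ → ℂ × ℂ)
    (hm' : ∀ p : ℝ × ℝ, m' p =
      (-(((a : ℂ) + 1) / (Complex.I * (k : ℂ)))) • m p + (Complex.I * (k : ℂ))⁻¹ • χ p) :
    ∀ p ∈ U, sdivC m' p = (r p : ℂ) ^ a *
      Complex.exp (Complex.I * (k : ℂ) * (r p : ℂ)) / (4 * (Real.pi : ℂ)) := by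
  intro p hp
  set s : ℝ := (p.1 - xp) ^ 2 + (p.2 - yp) ^ 2 with hs
  have hspos : 0 < s := Real.sqrt_pos.1 (hρ p ▸ hρpos p hp)
  have hrpos : 0 < Real.sqrt (s + h ^ 2) := Real.sqrt_pos.2 (by positivity)
  have hG := hasDerivAt_amplitude h hspos
    ((hasDerivAt_zpow_mul_cexp k a hrpos.ne').div_const (4 * (Real.pi : ℂ)))
  have hχeq : χ = fun q : ℝ × ℝ =>
      (fun t : ℝ => (Real.sqrt (t + h ^ 2) : ℂ) ^ (a + 1) *
        Complex.exp (Complex.I * (k : ℂ) * (Real.sqrt (t + h ^ 2) : ℂ)) /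
          (4 * (Real.pi : ℂ)) / (t : ℂ)) ((q.1 - xp) ^ 2 + (q.2 - yp) ^ 2) •
        (((q.1 - xp : ℝ) : ℂ), ((q.2 - yp : ℝ) : ℂ)) := by
    funext q
    have hsq : (ρ q : ℂ) ^ 2 = (((q.1 - xp) ^ 2 + (q.2 - yp) ^ 2 : ℝ) : ℂ) := by
      rw [hρ, ← Complex.ofReal_pow, Real.sq_sqrt (by positivity)]
    simp only [hχ, hsq, hr, div_div]
  have hχd : DifferentiableAt ℝ χ p := by
    obtain ⟨L, hL, -⟩ := hasFDerivAt_radial xp yp hG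
    exact hχeq ▸ hL.differentiableAt
  have hχdiv := sdivC_radial xp yp hG
  rw [← hχeq, ← hs] at hχdiv
  rw [funext hm', sdivC_smul_add_smul _ _ (hd p hp) hχd, hm p hp, hχdiv, hr p, ← hs]
  have hk' : (k : ℂ) ≠ 0 := by exact_mod_cast hk.ne'
  have hr' : (Real.sqrt (s + h ^ 2) : ℂ) ≠ 0 := by exact_mod_cast hrpos.ne'
  have hs' : (s : ℂ) ≠ 0 := by exact_mod_cast hspos.ne'
  have hpi : (Real.pi : ℂ) ≠ 0 := by exact_mod_cast Real.pi_ne_zero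
  rw [zpow_sub_one₀ hr', zpow_add_one₀ hr']
  field_simp
  ring
end

section
/- (Helmholtz singularity term, equations (4.43) seed data.) Let k > 0 be real, a ≥ 0 an integer, and h ∈ ℝ. For ε > 0, the inward-flux contour integral of χ_a over the circle of radius ε centered at (x_p, y_p), namely J(ε) = ε·∫_0^{2π} χ_a(x_p + ε cos φ, y_p + ε sin φ) · (−cos φ, −sin φ) dφ, equals −(ε² + h²)^{a/2}·e^{ik(ε²+h²)^{1/2}} / 2, and consequently lim_{ε→0⁺} J(ε) = −|h|^{a} e^{ik|h|} / 2. In particular, for a = 0 this gives the seed value T_{0,0,0} = lim_{ε→0⁺} J(ε)/(ik) = i·e^{ik|h|}/(2k). -/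
/-- Helmholtz singularity term, seed data of equations (4.43): flux of χ_a through
the shrinking circle, its closed form, its limit, and the seed value T_{0,0,0}. -/
theorem stmt7 (xp yp h k : ℝ) (hk : 0 < k) (a : ℕ)
    (r ρ : ℝ × ℝ → ℝ)
    (hr : ∀ p : ℝ × ℝ, r p = Real.sqrt ((p.1 - xp) ^ 2 + (p.2 - yp) ^ 2 + h ^ 2))
    (hρ : ∀ p : ℝ × ℝ, ρ p = Real.sqrt ((p.1 - xp) ^ 2 + (p.2 - yp) ^ 2))
    (χ : ℝ × ℝ → ℂ × ℂ)
    (hχ : ∀ p : ℝ × ℝ, χ p =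
      ((r p : ℂ) ^ a * Complex.exp (Complex.I * (k : ℂ) * (r p : ℂ)) /
        (4 * (Real.pi : ℂ) * (ρ p : ℂ) ^ 2)) • (((p.1 - xp : ℝ) : ℂ), ((p.2 - yp : ℝ) : ℂ)))
    (J : ℝ → ℂ)
    (hJ : ∀ ε : ℝ, J ε = (ε : ℂ) * ∫ φ in (0 : ℝ)..(2 * Real.pi),
      ((χ (xp + ε * Real.cos φ, yp + ε * Real.sin φ)).1 * (-((Real.cos φ : ℝ) : ℂ)) +
       (χ (xp + ε * Real.cos φ, yp + ε * Real.sin φ)).2 * (-((Real.sin φ : ℝ) : ℂ)))) :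
    (∀ ε > 0, J ε = -((((ε ^ 2 + h ^ 2) ^ ((a : ℝ) / 2) : ℝ) : ℂ)) *
        Complex.exp (Complex.I * (k : ℂ) * (Real.sqrt (ε ^ 2 + h ^ 2) : ℂ)) / 2) ∧
    Filter.Tendsto J (nhdsWithin 0 (Set.Ioi 0))
      (nhds (-((|h| ^ a : ℝ) : ℂ) * Complex.exp (Complex.I * (k : ℂ) * ((|h| : ℝ) : ℂ)) / 2)) ∧
    (a = 0 → Filter.Tendsto (fun ε => J ε / (Complex.I * (k : ℂ))) (nhdsWithin 0 (Set.Ioi 0))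
      (nhds (Complex.I * Complex.exp (Complex.I * (k : ℂ) * ((|h| : ℝ) : ℂ)) / (2 * (k : ℂ))))) := by
  have hclosed : ∀ ε > 0, J ε = -((Real.sqrt (ε ^ 2 + h ^ 2) ^ a : ℝ) : ℂ) *
      Complex.exp (Complex.I * (k : ℂ) * (Real.sqrt (ε ^ 2 + h ^ 2) : ℂ)) / 2 := by
    intro ε hε
    have hcircle (φ : ℝ) : (ε * Real.cos φ) ^ 2 + (ε * Real.sin φ) ^ 2 = ε ^ 2 := by
      linear_combination ε ^ 2 * Real.cos_sq_add_sin_sq φ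
    have hε0 : (ε : ℂ) ≠ 0 := by exact_mod_cast hε.ne'
    have hπ : (Real.pi : ℂ) ≠ 0 := by exact_mod_cast Real.pi_ne_zero
    have hflux (φ : ℝ) :
        (χ (xp + ε * Real.cos φ, yp + ε * Real.sin φ)).1 * (-((Real.cos φ : ℝ) : ℂ)) +
          (χ (xp + ε * Real.cos φ, yp + ε * Real.sin φ)).2 * (-((Real.sin φ : ℝ) : ℂ)) =
        -((Real.sqrt (ε ^ 2 + h ^ 2) : ℂ) ^ a *
          Complex.exp (Complex.I * (k : ℂ) * (Real.sqrt (ε ^ 2 + h ^ 2) : ℂ)) /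
          (4 * (Real.pi : ℂ) * (ε : ℂ) ^ 2)) * ε := by
      have htrig : ((Real.cos φ : ℝ) : ℂ) ^ 2 + ((Real.sin φ : ℝ) : ℂ) ^ 2 = 1 := by
        exact_mod_cast Real.cos_sq_add_sin_sq φ
      rw [hχ, hr, hρ]
      simp only [hcircle, Real.sqrt_sq hε.le, add_sub_cancel_left, Prod.smul_mk, smul_eq_mul,
        Complex.ofReal_mul]
      linear_combination (-((Real.sqrt (ε ^ 2 + h ^ 2) : ℂ) ^ a *
          Complex.exp (Complex.I * (k : ℂ) * (Real.sqrt (ε ^ 2 + h ^ 2) : ℂ)) /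
          (4 * (Real.pi : ℂ) * (ε : ℂ) ^ 2)) * ε) * htrig
    rw [hJ, intervalIntegral.integral_congr fun φ _ => hflux φ, intervalIntegral.integral_const,
      Complex.real_smul]
    push_cast
    field_simp
    ring
  have hlim : Filter.Tendsto J (nhdsWithin 0 (Set.Ioi 0))
      (nhds (-((|h| ^ a : ℝ) : ℂ) * Complex.exp (Complex.I * (k : ℂ) * ((|h| : ℝ) : ℂ)) / 2)) := by
    have hcont : Continuous fun ε : ℝ => -((Real.sqrt (ε ^ 2 + h ^ 2) ^ a : ℝ) : ℂ) *
        Complex.exp (Complex.I * (k : ℂ) * (Real.sqrt (ε ^ 2 + h ^ 2) : ℂ)) / 2 := by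
      fun_prop
    have ht := (hcont.tendsto 0).mono_left (nhdsWithin_le_nhds (s := Set.Ioi 0))
    rw [show (0 : ℝ) ^ 2 + h ^ 2 = h ^ 2 by ring, Real.sqrt_sq_eq_abs] at ht
    refine ht.congr' ?_
    filter_upwards [self_mem_nhdsWithin] with ε hε
    exact (hclosed ε hε).symm
  refine ⟨fun ε hε => ?_, hlim, ?_⟩
  · rw [hclosed ε hε, Real.rpow_div_two_eq_sqrt _ (by positivity), Real.rpow_natCast]
  · rintro rfl
    have hk0 : (k : ℂ) ≠ 0 := by exact_mod_cast hk.ne'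
    convert hlim.div_const (Complex.I * (k : ℂ)) using 2
    simp only [pow_zero, Complex.ofReal_one]
    field_simp
    simp
end

section
/- (Closed-form primitive for k_{-1}, Appendix B.) Let y', z' ∈ ℝ with y' ≠ 0 and z' ≠ 0, and set r(x) = (x² + y'² + z'²)^{1/2}. Then for every x ∈ ℝ: d/dx [ (1/(y'·|z'|)) · arctan( y' x / ( |z'| r(x) ) ) ] = 1 / ( r(x) · (x² + z'²) ). -/
/-- Closed-form primitive for k_{-1}, Appendix B. -/
theorem stmt14 (y' z' : ℝ) (hy : y' ≠ 0) (hz : z' ≠ 0)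
    (r : ℝ → ℝ) (hr : ∀ x, r x = Real.sqrt (x ^ 2 + y' ^ 2 + z' ^ 2)) :
    ∀ x : ℝ,
      HasDerivAt (fun t => (1 / (y' * |z'|)) * Real.arctan (y' * t / (|z'| * r t)))
        (1 / (r x * (x ^ 2 + z' ^ 2))) x := by
  intro x
  have ha : 0 < |z'| := abs_pos.mpr hz
  have hpos : 0 < x ^ 2 + y' ^ 2 + z' ^ 2 := by positivity
  have hs : 0 < r x := by rw [hr]; exact Real.sqrt_pos.mpr hpos
  have hsq : r x ^ 2 = x ^ 2 + y' ^ 2 + |z'| ^ 2 := by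
    rw [hr, Real.sq_sqrt hpos.le, sq_abs]
  have hr' : HasDerivAt r (x / r x) x := by
    have h : HasDerivAt (fun t : ℝ => t ^ 2 + y' ^ 2 + z' ^ 2) (2 * x) x := by
      simpa using (((hasDerivAt_id x).pow 2).add_const (y' ^ 2)).add_const (z' ^ 2)
    have h' := h.sqrt hpos.ne'
    rw [← funext hr, ← hr, mul_div_mul_left _ _ two_ne_zero] at h'
    exact h'
  have hmain := ((((hasDerivAt_id x).const_mul y').div (hr'.const_mul |z'|)
    (mul_pos ha hs).ne').arctan).const_mul (1 / (y' * |z'|))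
  refine hmain.congr_deriv ?_
  simp only [Pi.div_apply, id, mul_one]
  rw [← sq_abs z']
  generalize |z'| = a at *
  generalize r x = s at *
  have hone : 1 + (y' * x / (a * s)) ^ 2
      = (x ^ 2 + a ^ 2) * (y' ^ 2 + a ^ 2) / (a * s) ^ 2 := by
    field_simp
    linear_combination a ^ 2 * hsq
  have hnum : y' * (a * s) - y' * x * (a * (x / s)) = y' * a * (y' ^ 2 + a ^ 2) / s := by
    field_simp
    linear_combination hsq
  rw [hone, hnum]
  field_simp
end
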